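/- The censoring adjustment function h satisfies 0 < h(z) < 1 for every z ∈ ℝ. -/

import Mathlib

open MeasureTheory Real Filter

/-- The standard normal density. -/
noncomputable def normPDF (t : ℝ) : ℝ := Real.exp (-t ^ 2 / 2) / Real.sqrt (2 * Real.pi)

/-- The standard normal cumulative distribution function. -/
noncomputable def normCDF (t : ℝ) : ℝ := ∫ s in Set.Iic t, normPDF s

/-- The censoring adjustment function `h(z) = Φ(z) − z·φ(z) + φ(z)²/(1 − Φ(z))`. -/
noncomputable def censorAdj (z : ℝ) : ℝ :=
  normCDF z - z * normPDF z + (normPDF z) ^ 2 / (1 - normCDF z)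

open scoped Topology

lemma normPDF_eq_gaussianPDFReal : normPDF = ProbabilityTheory.gaussianPDFReal 0 1 := by
  ext t
  simp [normPDF, ProbabilityTheory.gaussianPDFReal, div_eq_inv_mul]

lemma normCDF_eq_cdf_gaussianReal :
    normCDF = ProbabilityTheory.cdf (ProbabilityTheory.gaussianReal 0 1) := by
  ext t
  rw [ProbabilityTheory.cdf_eq_real, measureReal_def,
    ProbabilityTheory.gaussianReal_apply_eq_integral _ one_ne_zero, ENNReal.toReal_ofReal]
  · rw [normCDF, normPDF_eq_gaussianPDFReal]
  · exact integral_nonneg (ProbabilityTheory.gaussianPDFReal_nonneg _ _)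

lemma normPDF_pos (t : ℝ) : 0 < normPDF t := by
  unfold normPDF
  positivity

lemma hasDerivAt_normPDF (t : ℝ) : HasDerivAt normPDF (-t * normPDF t) t := by
  have h := (((hasDerivAt_pow 2 t).neg.div_const 2).exp).div_const (√(2 * π))
  refine h.congr_deriv ?_
  simp only [normPDF, Pi.neg_apply]
  push_cast
  ring

lemma continuous_normPDF : Continuous normPDF :=
  continuous_iff_continuousAt.2 fun t => (hasDerivAt_normPDF t).continuousAt

lemma integrable_normPDF : Integrable normPDF := by
  rw [normPDF_eq_gaussianPDFReal]
  exact ProbabilityTheory.integrable_gaussianPDFReal 0 1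

lemma hasDerivAt_normCDF (t : ℝ) : HasDerivAt normCDF (normPDF t) t := by
  have h : normCDF = fun x => (∫ s in (0 : ℝ)..x, normPDF s) + normCDF 0 := by
    ext x
    rw [← intervalIntegral.integral_Iic_sub_Iic integrable_normPDF.integrableOn
      integrable_normPDF.integrableOn]
    simp [normCDF]
  rw [h]
  exact (continuous_normPDF.integral_hasStrictDerivAt 0 t).hasDerivAt.add_const _

lemma strictMono_normCDF : StrictMono normCDF :=
  strictMono_of_hasDerivAt_pos hasDerivAt_normCDF normPDF_pos

lemma tendsto_normCDF_atBot : Tendsto normCDF atBot (𝓝 0) := by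
  rw [normCDF_eq_cdf_gaussianReal]
  exact ProbabilityTheory.tendsto_cdf_atBot _

lemma tendsto_normCDF_atTop : Tendsto normCDF atTop (𝓝 1) := by
  rw [normCDF_eq_cdf_gaussianReal]
  exact ProbabilityTheory.tendsto_cdf_atTop _

lemma one_sub_normCDF_pos (t : ℝ) : 0 < 1 - normCDF t :=
  sub_pos.2 <| (strictMono_normCDF (lt_add_one t)).trans_le <|
    strictMono_normCDF.monotone.ge_of_tendsto tendsto_normCDF_atTop _

lemma hasDerivAt_one_sub_normCDF (t : ℝ) :
    HasDerivAt (fun x => 1 - normCDF x) (-normPDF t) t :=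
  (hasDerivAt_normCDF t).const_sub 1

lemma tendsto_one_sub_normCDF_atTop : Tendsto (fun x => 1 - normCDF x) atTop (𝓝 0) := by
  simpa using tendsto_normCDF_atTop.const_sub 1

lemma tendsto_normPDF_cocompact : Tendsto normPDF (cocompact ℝ) (𝓝 0) := by
  have h := (tendsto_rpow_abs_mul_exp_neg_mul_sq_cocompact (a := 1 / 2) (by norm_num) 0).div_const
    (√(2 * π))
  rw [zero_div] at h
  refine h.congr fun x => ?_
  rw [normPDF, rpow_zero, one_mul]
  ring_nf

lemma tendsto_mul_normPDF_cocompact :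
    Tendsto (fun x => x * normPDF x) (cocompact ℝ) (𝓝 0) := by
  have h := (tendsto_rpow_abs_mul_exp_neg_mul_sq_cocompact (a := 1 / 2) (by norm_num) 1).div_const
    (√(2 * π))
  rw [zero_div] at h
  refine (tendsto_zero_iff_abs_tendsto_zero _).2 (h.congr fun x => ?_)
  rw [Function.comp_apply, abs_mul, abs_of_pos (normPDF_pos x), normPDF, rpow_one]
  ring_nf

lemma tendsto_one_sub_normCDF_div_normPDF :
    Tendsto (fun x => (1 - normCDF x) / normPDF x) atTop (𝓝 0) := by
  refine HasDerivAt.lhopital_zero_atTop (.of_forall hasDerivAt_one_sub_normCDF)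
    (.of_forall hasDerivAt_normPDF) ?_ tendsto_one_sub_normCDF_atTop
    (tendsto_normPDF_cocompact.mono_left atTop_le_cocompact) ?_
  · filter_upwards [eventually_gt_atTop 0] with x hx
    exact mul_ne_zero (neg_ne_zero.2 hx.ne') (normPDF_pos x).ne'
  · refine tendsto_inv_atTop_zero.congr' ?_
    filter_upwards [eventually_gt_atTop 0] with x hx
    have := (normPDF_pos x).ne'
    field_simp

/-- The Mills ratio inequality `z (1 - Φ(z)) < φ(z)`. -/
lemma mul_one_sub_normCDF_lt_normPDF (z : ℝ) : z * (1 - normCDF z) < normPDF z := by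
  have hanti : StrictAnti fun x => normPDF x - x * (1 - normCDF x) := by
    refine strictAnti_of_hasDerivAt_neg (f' := fun x => -(1 - normCDF x)) (fun x => ?_)
      fun x => neg_neg_of_pos (one_sub_normCDF_pos x)
    refine ((hasDerivAt_normPDF x).sub
      ((hasDerivAt_id x).mul (hasDerivAt_one_sub_normCDF x))).congr_deriv ?_
    simp only [id]
    ring
  have hlim : Tendsto (fun x => normPDF x - x * (1 - normCDF x)) atTop (𝓝 0) := by
    have h := (tendsto_normPDF_cocompact.mono_left atTop_le_cocompact).sub
      ((tendsto_mul_normPDF_cocompact.mono_left atTop_le_cocompact).mul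
        tendsto_one_sub_normCDF_div_normPDF)
    rw [mul_zero, sub_zero] at h
    refine h.congr fun x => ?_
    have := (normPDF_pos x).ne'
    field_simp
  exact sub_pos.1 ((hanti.antitone.le_of_tendsto hlim (z + 1)).trans_lt (hanti (lt_add_one z)))

lemma hasDerivAt_censorAdj (z : ℝ) :
    HasDerivAt censorAdj (normPDF z * (normPDF z / (1 - normCDF z) - z) ^ 2) z := by
  have hQ := (one_sub_normCDF_pos z).ne'
  refine (((hasDerivAt_normCDF z).sub ((hasDerivAt_id z).mul (hasDerivAt_normPDF z))).add
    (((hasDerivAt_normPDF z).pow 2).div (hasDerivAt_one_sub_normCDF z) hQ)).congr_deriv ?_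
  simp only [id, Pi.pow_apply]
  field_simp
  ring

lemma strictMono_censorAdj : StrictMono censorAdj := by
  refine strictMono_of_hasDerivAt_pos hasDerivAt_censorAdj fun z => ?_
  have h : 0 < normPDF z / (1 - normCDF z) - z :=
    sub_pos.2 ((lt_div_iff₀ (one_sub_normCDF_pos z)).2 (mul_one_sub_normCDF_lt_normPDF z))
  exact mul_pos (normPDF_pos z) (pow_pos h 2)

lemma tendsto_censorAdj_atBot : Tendsto censorAdj atBot (𝓝 0) := by
  have h := (tendsto_normCDF_atBot.sub
    (tendsto_mul_normPDF_cocompact.mono_left atBot_le_cocompact)).add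
    (((tendsto_normPDF_cocompact.mono_left atBot_le_cocompact).pow 2).div
      (tendsto_normCDF_atBot.const_sub 1) (by norm_num))
  simpa [funext censorAdj.eq_1] using h

lemma tendsto_normPDF_sq_div_one_sub_normCDF :
    Tendsto (fun x => normPDF x ^ 2 / (1 - normCDF x)) atTop (𝓝 0) := by
  have hsq : Tendsto (fun x => normPDF x ^ 2) atTop (𝓝 0) := by
    simpa using (tendsto_normPDF_cocompact.mono_left atTop_le_cocompact).pow 2
  refine HasDerivAt.lhopital_zero_atTop (.of_forall fun x => (hasDerivAt_normPDF x).pow 2)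
    (.of_forall hasDerivAt_one_sub_normCDF)
    (.of_forall fun x => neg_ne_zero.2 (normPDF_pos x).ne') hsq tendsto_one_sub_normCDF_atTop ?_
  have h := (tendsto_mul_normPDF_cocompact.mono_left atTop_le_cocompact).const_mul 2
  rw [mul_zero] at h
  refine h.congr fun x => ?_
  have := (normPDF_pos x).ne'
  field_simp
  simp [mul_comm]

lemma tendsto_censorAdj_atTop : Tendsto censorAdj atTop (𝓝 1) := by
  simpa [funext censorAdj.eq_1] using (tendsto_normCDF_atTop.sub
    (tendsto_mul_normPDF_cocompact.mono_left atTop_le_cocompact)).add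
    tendsto_normPDF_sq_div_one_sub_normCDF

/-- The censoring adjustment function satisfies `0 < h(z) < 1` for every `z ∈ ℝ`. -/
theorem censorAdj_mem_Ioo (z : ℝ) : 0 < censorAdj z ∧ censorAdj z < 1 :=
  ⟨(strictMono_censorAdj.monotone.le_of_tendsto tendsto_censorAdj_atBot (z - 1)).trans_lt
      (strictMono_censorAdj (sub_one_lt z)),
    (strictMono_censorAdj (lt_add_one z)).trans_le
      (strictMono_censorAdj.monotone.ge_of_tendsto tendsto_censorAdj_atTop (z + 1))⟩
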